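/- arXiv:2005.02250 — 2 statements merged into one kernel-verified Lean document; each statement's English description precedes it below -/
import Mathlib

section
/- Let ℋ be a set of graphs and h an integer such that for every H ∈ ℋ the complement of H contains an induced cycle of length at most h. Then for every real number c > 0 there exists a finite ℋ-free graph G with at least one vertex such that χ(G) > c · ω(G). In particular, the class of ℋ-free graphs admits no linear χ-binding function. -/
open SimpleGraph

/-- `G` is `H`-free: no induced subgraph of `G` is isomorphic to `H`. -/
def IndFree {α β : Type*} (H : SimpleGraph α) (G : SimpleGraph β) : Prop :=
  ∀ s : Set β, ¬ Nonempty (H ≃g G.induce s)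

/-- The banner: a 4-cycle `0-1-2-3-0` together with a pendant vertex `4` adjacent to `0`. -/
def banner : SimpleGraph (Fin 5) :=
  SimpleGraph.fromEdgeSet {s(0,1), s(1,2), s(2,3), s(3,0), s(0,4)}

/-- The co-banner: the complement of the banner. -/
def coBanner : SimpleGraph (Fin 5) := bannerᶜ

/-- `2K₂`: the disjoint union of two edges. -/
def twoK2 : SimpleGraph (Fin 4) := SimpleGraph.fromEdgeSet {s(0,1), s(2,3)}

/-- `3K₁`: three pairwise nonadjacent vertices. -/
def threeK1 : SimpleGraph (Fin 3) := ⊥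

/-- The 5-wheel: a 5-cycle `0-1-2-3-4-0` plus a hub `5` adjacent to all cycle vertices. -/
def wheel5 : SimpleGraph (Fin 6) :=
  SimpleGraph.fromEdgeSet
    {s(0,1), s(1,2), s(2,3), s(3,4), s(4,0), s(5,0), s(5,1), s(5,2), s(5,3), s(5,4)}

/-- A nonempty set `M` is a module if every vertex outside `M` is adjacent to all
or to none of the vertices of `M`. -/
def IsModule {V : Type*} (G : SimpleGraph V) (M : Set V) : Prop :=
  M.Nonempty ∧ ∀ v ∉ M, (∀ u ∈ M, G.Adj v u) ∨ (∀ u ∈ M, ¬ G.Adj v u)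

/-- `X` is a clique-separator of modules in `G`. -/
def IsCliqueSeparatorOfModules {V : Type*} (G : SimpleGraph V) (X : Set V) : Prop :=
  (∃ (k : ℕ) (Xs : Fin k → Set V),
      (∀ i, IsModule G (Xs i)) ∧
      (∀ i j, i ≠ j → Disjoint (Xs i) (Xs j)) ∧
      (∀ i j, i ≠ j → ∀ u ∈ Xs i, ∀ v ∈ Xs j, G.Adj u v) ∧
      X = ⋃ i, Xs i) ∧
  (∃ A B : Set V, A ∪ B = Set.univ ∧ (A \ B).Nonempty ∧ (B \ A).Nonempty ∧
      (∀ a ∈ A \ B, ∀ b ∈ B \ A, ¬ G.Adj a b) ∧ A ∩ B = X)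

/-- A graph is prime if it has no homogeneous set,
i.e. no module `M` with `1 < |M| < |V(G)|`. -/
def IsPrime {V : Type*} (G : SimpleGraph V) : Prop :=
  ¬ ∃ M : Set V, IsModule G M ∧ 1 < M.ncard ∧ M.ncard < Nat.card V

/-- A nonempty graph is critical if deleting any vertex decreases the chromatic number. -/
def IsCritical {V : Type*} (G : SimpleGraph V) : Prop :=
  Nonempty V ∧ ∀ v : V, (G.induce {u | u ≠ v}).chromaticNumber < G.chromaticNumber

/-- `G` is a `non-empty, 2K₁-free'-expansion of `G'`: the fibres of `f` partition `V(G)`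
into nonempty cliques, with complete/empty bipartite connections according to `G'`. -/
def IsExpansionOf {V W : Type*} (G : SimpleGraph V) (G' : SimpleGraph W) : Prop :=
  ∃ f : V → W, Function.Surjective f ∧
    (∀ u v, u ≠ v → f u = f v → G.Adj u v) ∧
    (∀ u v, f u ≠ f v → (G.Adj u v ↔ G'.Adj (f u) (f v)))

/-- The weighted chromatic number `χ_q(G)`: the least `k` such that every vertex `v`
can be assigned a set of `q v` colours from `{1,…,k}` with disjoint sets on adjacent
vertices. -/
noncomputable def wChromaticNumber {V : Type*} (G : SimpleGraph V) (q : V → ℕ) : ℕ :=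
  sInf {k | ∃ L : V → Finset (Fin k), (∀ v, (L v).card = q v) ∧
    ∀ ⦃u v⦄, G.Adj u v → Disjoint (L u) (L v)}

/-- The weighted clique number `ω_q(G)`: the maximum total weight of a clique. -/
noncomputable def wCliqueNum {V : Type*} (G : SimpleGraph V) (q : V → ℕ) : ℕ :=
  sSup {m | ∃ s : Finset V, G.IsClique (s : Set V) ∧ m = ∑ v ∈ s, q v}

/-- `Q(F)`: a path `u₁u₂u₃u₄` whose third vertex `u₃` has been replaced by a copy of `F`,
each of whose vertices is adjacent to both `u₂` and `u₄`. Here `inr 0 = u₁`, `inr 1 = u₂`,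
`inr 2 = u₄`, and `inl w` are the vertices of the copy of `F`. -/
def QGraph {W : Type*} (F : SimpleGraph W) : SimpleGraph (W ⊕ Fin 3) :=
  SimpleGraph.fromRel (fun a b =>
    (∃ w w', a = Sum.inl w ∧ b = Sum.inl w' ∧ F.Adj w w') ∨
    (a = Sum.inr 0 ∧ b = Sum.inr 1) ∨
    (∃ w, a = Sum.inl w ∧ (b = Sum.inr 1 ∨ b = Sum.inr 2)))

/-- The join of two graphs: all edges of both graphs plus all edges in between. -/
def joinGraph {α β : Type*} (G₁ : SimpleGraph α) (G₂ : SimpleGraph β) :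
    SimpleGraph (α ⊕ β) :=
  SimpleGraph.fromRel (fun a b =>
    (∃ u v, a = Sum.inl u ∧ b = Sum.inl v ∧ G₁.Adj u v) ∨
    (∃ u v, a = Sum.inr u ∧ b = Sum.inr v ∧ G₂.Adj u v) ∨
    (∃ u v, a = Sum.inl u ∧ b = Sum.inr v))

/-- `H` has a spanning complete bipartite subgraph. -/
def HasSpanningCompleteBipartite {α : Type*} (H : SimpleGraph α) : Prop :=
  ∃ A B : Set α, A.Nonempty ∧ B.Nonempty ∧ Disjoint A B ∧ A ∪ B = Set.univ ∧
    ∀ a ∈ A, ∀ b ∈ B, H.Adj a b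

/-- `G'` is a `q`-expansion of `G`: each vertex `u` of `G` is replaced by a clique on
`q u` vertices, joined completely or not at all according to adjacency in `G`. -/
def IsWeightedExpansion {V' V : Type*} (G' : SimpleGraph V') (G : SimpleGraph V)
    (q : V → ℕ) : Prop :=
  ∃ f : V' → V,
    (∀ v : V, Nat.card (f ⁻¹' {v}) = q v) ∧
    (∀ a b : V', a ≠ b → f a = f b → G'.Adj a b) ∧
    (∀ a b : V', f a ≠ f b → (G'.Adj a b ↔ G.Adj (f a) (f b)))

/-- `q` is `⊲`-minimal: no weight function pointwise at most `q` with strictly smaller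
total weight has the same weighted chromatic number. -/
def IsTriMinimal {V : Type*} [Fintype V] (G : SimpleGraph V) (q : V → ℕ) : Prop :=
  ¬ ∃ q' : V → ℕ, (∀ v, q' v ≤ q v) ∧ (∑ v, q' v) < (∑ v, q v) ∧
      wChromaticNumber G q' = wChromaticNumber G q

/-- `G` has no cycle with at least `3` and at most `h` vertices. -/
def NoShortCycle {V : Type*} (G : SimpleGraph V) (h : ℕ) : Prop :=
  ∀ m : ℕ, 2 ≤ m → m + 1 ≤ h → ∀ f : Fin (m + 1) → V, Function.Injective f →
    ¬ ∀ i, G.Adj (f i) (f (i + 1))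

open scoped Classical in
/-- The vertices at distance at most `r` from `u`. -/
noncomputable def distBall {V : Type*} [Fintype V] (G : SimpleGraph V) : ℕ → V → Finset V
  | 0, u => {u}
  | r + 1, u => (distBall G r u).biUnion fun w => insert w (G.neighborFinset w)

section DistBall

variable {V : Type*} [Fintype V] {G : SimpleGraph V}

theorem distBall_subset_succ (r : ℕ) (u : V) : distBall G r u ⊆ distBall G (r + 1) u := by
  classical
  intro w hw
  simp only [distBall, Finset.mem_biUnion]
  exact ⟨w, hw, Finset.mem_insert_self _ _⟩

theorem distBall_mono {r s : ℕ} (hrs : r ≤ s) (u : V) : distBall G r u ⊆ distBall G s u :=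
  monotone_nat_of_le_succ (f := fun r => distBall G r u) (fun r => distBall_subset_succ r u) hrs

theorem mem_distBall_self (r : ℕ) (u : V) : u ∈ distBall G r u :=
  distBall_mono (Nat.zero_le r) u (by simp [distBall])

theorem mem_distBall_succ {r : ℕ} {u v w : V} (hv : v ∈ distBall G r u) (hvw : G.Adj v w) :
    w ∈ distBall G (r + 1) u := by
  classical
  simp only [distBall, Finset.mem_biUnion]
  exact ⟨v, hv, by simp [hvw]⟩

open scoped Classical in
theorem card_distBall_le {Δ : ℕ} (hΔ : ∀ v, G.degree v ≤ Δ) (r : ℕ) (u : V) :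
    (distBall G r u).card ≤ (Δ + 1) ^ r := by
  induction r with
  | zero => simp [distBall]
  | succ r ih =>
    rw [distBall, pow_succ]
    refine (Finset.card_biUnion_le_card_mul _ _ (Δ + 1) fun w _ => ?_).trans
      (Nat.mul_le_mul_right _ ih)
    refine (Finset.card_insert_le _ _).trans ?_
    have := hΔ w
    rw [card_neighborFinset_eq_degree]
    lia

end DistBall

open scoped Fin.NatCast Fin.CommRing in
/-- Adding an edge between two vertices at distance more than `h` creates no short cycle. -/
theorem NoShortCycle.sup_edge {V : Type*} [Fintype V] {G : SimpleGraph V} {h : ℕ} {u v : V}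
    (hG : NoShortCycle G h) (huv : v ∉ distBall G h u) (hvu : u ∉ distBall G h v) :
    NoShortCycle (G ⊔ edge u v) h := by
  intro m hm hmh f hf hadj
  have h2 : (2 : Fin (m + 1)) ≠ 0 := by
    have : ((2 : ℕ) : Fin (m + 1)) ≠ 0 := by
      rw [Ne, Fin.natCast_eq_zero]
      intro hd
      have := Nat.le_of_dvd two_pos hd
      lia
    exact_mod_cast this
  by_cases hall : ∀ i, G.Adj (f i) (f (i + 1))
  · exact hG m hm hmh f hf hall
  push Not at hall
  obtain ⟨i, hi⟩ := hall
  have hnew : ∀ j, ¬ G.Adj (f j) (f (j + 1)) →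
      (f j = u ∧ f (j + 1) = v) ∨ (f j = v ∧ f (j + 1) = u) := by
    intro j hj
    have := hadj j
    rw [sup_adj, edge_adj] at this
    tauto
  have hother : ∀ j, j ≠ i → G.Adj (f j) (f (j + 1)) := by
    intro j hji
    by_contra hj
    have hswap : f j = f (i + 1) → f (j + 1) = f i → False := by
      intro ha hb
      have ha := hf ha
      have hb := hf hb
      apply h2
      have : i + 2 = i := by
        rw [← one_add_one_eq_two, ← add_assoc, ← ha, hb]
      simpa using this
    rcases hnew i hi with ⟨ha, hb⟩ | ⟨ha, hb⟩ <;>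
    rcases hnew j hj with ⟨hc, hd⟩ | ⟨hc, hd⟩
    · exact hji (hf (hc.trans ha.symm))
    · exact hswap (hc.trans hb.symm) (hd.trans ha.symm)
    · exact hswap (hc.trans hb.symm) (hd.trans ha.symm)
    · exact hji (hf (hc.trans ha.symm))
  have hreach : ∀ j : ℕ, j ≤ m → f (i + 1 + (j : Fin (m + 1))) ∈ distBall G j (f (i + 1)) := by
    intro j
    induction j with
    | zero => intro _; simp [distBall]
    | succ j ih =>
      intro hj
      have hne : i + 1 + (j : Fin (m + 1)) ≠ i := by
        rw [add_assoc, Ne, add_eq_left]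
        have : (((1 + j : ℕ)) : Fin (m + 1)) ≠ 0 := by
          rw [Ne, Fin.natCast_eq_zero]
          intro hd
          have := Nat.le_of_dvd (by lia) hd
          lia
        exact_mod_cast this
      have := mem_distBall_succ (ih (by lia)) (hother _ hne)
      rw [Nat.cast_succ, ← add_assoc]
      exact this
  have hend := distBall_mono (show m ≤ h by lia) _ (hreach m le_rfl)
  have hlast : i + 1 + (m : Fin (m + 1)) = i := by
    have : (((1 + m : ℕ)) : Fin (m + 1)) = 0 := by
      rw [Fin.natCast_eq_zero, add_comm]
    rw [add_assoc, add_eq_left]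
    exact_mod_cast this
  rw [hlast] at hend
  rcases hnew i hi with ⟨ha, hb⟩ | ⟨ha, hb⟩
  · rw [ha, hb] at hend; exact hvu hend
  · rw [ha, hb] at hend; exact huv hend

open scoped Classical in
/-- If every set of a family meets `P` in many pairs, some pair of `P` lies in many of them. -/
theorem exists_pair_mem_many {V : Type*} [Fintype V] {A : Finset (Finset V)}
    {P : Finset (V × V)} {g m : ℕ} (hg : 0 < g) (hA : A.Nonempty)
    (hP : ∀ S ∈ A, g ≤ m * (P.filter fun p => p.1 ∈ S ∧ p.2 ∈ S).card) :
    ∃ p ∈ P, g * A.card ≤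
      m * Fintype.card V ^ 2 * (A.filter fun S => p.1 ∈ S ∧ p.2 ∈ S).card := by
  have hPne : P.Nonempty := by
    obtain ⟨S, hS⟩ := hA
    by_contra hne
    rw [Finset.not_nonempty_iff_eq_empty] at hne
    have := hP S hS
    simp [hne] at this
    lia
  have hPcard : P.card ≤ Fintype.card V ^ 2 := by
    rw [sq, ← Fintype.card_prod]
    exact Finset.card_le_univ P
  apply Finset.exists_le_of_sum_le hPne
  have hdouble := Finset.sum_card_bipartiteAbove_eq_sum_card_bipartiteBelow
    (fun (p : V × V) (S : Finset V) => p.1 ∈ S ∧ p.2 ∈ S) (s := P) (t := A)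
  simp only [Finset.bipartiteAbove, Finset.bipartiteBelow] at hdouble
  rw [Finset.sum_const, smul_eq_mul, ← Finset.mul_sum, hdouble]
  have hsum : g * A.card ≤
      m * ∑ S ∈ A, (P.filter fun p => p.1 ∈ S ∧ p.2 ∈ S).card := by
    rw [Finset.mul_sum, mul_comm, ← smul_eq_mul]
    exact Finset.card_nsmul_le_sum _ _ _ hP
  calc P.card * (g * A.card)
      ≤ Fintype.card V ^ 2 *
        (m * ∑ S ∈ A, (P.filter fun p => p.1 ∈ S ∧ p.2 ∈ S).card) :=
        Nat.mul_le_mul hPcard hsum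
    _ = _ := by ring

open scoped Classical in
/-- The independent sets of `G` with exactly `k` vertices. -/
noncomputable def indepSetsOfCard {V : Type*} [Fintype V] (G : SimpleGraph V) (k : ℕ) :
    Finset (Finset V) :=
  Finset.univ.filter fun S => S.card = k ∧ G.IsIndepSet (S : Set V)

open scoped Classical in
theorem card_indepSetsOfCard_sup_edge {V : Type*} [Fintype V] (G : SimpleGraph V) (k : ℕ)
    {u v : V} (huv : u ≠ v) :
    (indepSetsOfCard (G ⊔ edge u v) k).card +
      ((indepSetsOfCard G k).filter fun S => u ∈ S ∧ v ∈ S).card ≤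
      (indepSetsOfCard G k).card := by
  rw [← Finset.card_filter_add_card_filter_not (s := indepSetsOfCard G k)
    (fun S => u ∈ S ∧ v ∈ S), add_comm]
  refine Nat.add_le_add_left (Finset.card_le_card fun S hS => ?_) _
  simp only [indepSetsOfCard, Finset.mem_filter, Finset.mem_univ, true_and] at hS ⊢
  refine ⟨⟨hS.1, fun a ha b hb hab hadj => hS.2 ha hb hab (Or.inl hadj)⟩, fun hmem => ?_⟩
  exact hS.2 hmem.1 hmem.2 huv (Or.inr ((edge_adj ..).2 ⟨Or.inl ⟨rfl, rfl⟩, huv⟩))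

open scoped Classical in
/-- `G` has no short cycles, maximum degree at most `Δ`, and at most `t` edges. -/
structure IsSparse {V : Type*} [Fintype V] (G : SimpleGraph V) (h Δ t : ℕ) : Prop where
  noShortCycle : NoShortCycle G h
  degree_le : ∀ v, G.degree v ≤ Δ
  card_edges_le : G.edgeFinset.card ≤ t

open scoped Classical in
/-- The pairs of vertices that may be joined while keeping the graph sparse. -/
noncomputable def joinablePairs {V : Type*} [Fintype V] (G : SimpleGraph V) (h Δ : ℕ) :
    Finset (V × V) :=
  Finset.univ.filter fun p =>
    G.degree p.1 < Δ ∧ G.degree p.2 < Δ ∧ p.2 ∉ distBall G h p.1 ∧ p.1 ∉ distBall G h p.2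

open scoped Classical in
theorem IsSparse.sup_edge {V : Type*} [Fintype V] {G : SimpleGraph V} {h Δ t : ℕ}
    (hG : IsSparse G h Δ t) (hh : 1 ≤ h) {u v : V} (hp : (u, v) ∈ joinablePairs G h Δ) :
    u ≠ v ∧ IsSparse (G ⊔ edge u v) h Δ (t + 1) := by
  simp only [joinablePairs, Finset.mem_filter, Finset.mem_univ, true_and] at hp
  obtain ⟨hu, hv, huv, hvu⟩ := hp
  have hne : u ≠ v := by
    rintro rfl
    exact huv (mem_distBall_self _ _)
  have hnadj : ¬ G.Adj u v := fun hadj =>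
    huv (distBall_mono hh _ (mem_distBall_succ (mem_distBall_self 0 u) hadj))
  refine ⟨hne, hG.noShortCycle.sup_edge huv hvu, fun w => ?_, ?_⟩
  · have hext : ∀ x y : V, (∀ z, (G ⊔ edge u v).Adj x z → G.Adj x z ∨ z = y) →
        G.degree x < Δ → (G ⊔ edge u v).degree x ≤ Δ := by
      intro x y hz hx
      have hsub : (G ⊔ edge u v).neighborFinset x ⊆ insert y (G.neighborFinset x) := by
        intro z hzx
        rw [mem_neighborFinset] at hzx
        rw [Finset.mem_insert, mem_neighborFinset]
        exact (hz z hzx).symm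
      have := (Finset.card_le_card hsub).trans (Finset.card_insert_le _ _)
      rw [card_neighborFinset_eq_degree, card_neighborFinset_eq_degree] at this
      lia
    by_cases hwu : w = u
    · subst hwu
      convert hext w v (fun z hz => ?_) hu
      rw [sup_adj, edge_adj] at hz
      tauto
    by_cases hwv : w = v
    · subst hwv
      convert hext w u (fun z hz => ?_) hv
      rw [sup_adj, edge_adj] at hz
      tauto
    refine le_trans (le_of_eq ?_) (hG.degree_le w)
    rw [← card_neighborFinset_eq_degree, ← card_neighborFinset_eq_degree]
    congr 1
    ext z
    rw [mem_neighborFinset, mem_neighborFinset, sup_adj, edge_adj]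
    tauto
  · refine le_trans (le_of_eq ?_) (Nat.succ_le_succ hG.card_edges_le)
    convert card_edgeFinset_sup_edge G hnadj hne

open scoped Classical in
theorem IsSparse.card_not_joinable_le {V : Type*} [Fintype V] {G : SimpleGraph V} {h Δ t b : ℕ}
    (hG : IsSparse G h Δ t) (hb : 2 * t ≤ b * Δ) (hΔ : 0 < Δ) :
    (joinablePairs G h Δ)ᶜ.card ≤
      2 * (b * Fintype.card V) + 2 * (Fintype.card V * (Δ + 1) ^ h) := by
  set D : Finset V := Finset.univ.filter fun v => Δ ≤ G.degree v with hD
  set B : Finset (V × V) := Finset.univ.filter fun p => p.2 ∈ distBall G h p.1 with hB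
  have hDcard : D.card ≤ b := by
    have h1 : D.card * Δ ≤ ∑ v, G.degree v := by
      rw [← smul_eq_mul]
      refine (Finset.card_nsmul_le_sum D (fun v => G.degree v) Δ ?_).trans
        (Finset.sum_le_sum_of_subset (Finset.subset_univ D))
      intro v hv
      exact (Finset.mem_filter.1 hv).2
    rw [sum_degrees_eq_twice_card_edges] at h1
    have h2 := hG.card_edges_le
    exact Nat.le_of_mul_le_mul_right (by lia) hΔ
  have hBcard : B.card ≤ Fintype.card V * (Δ + 1) ^ h := by
    have hsub : B ⊆ (Finset.univ : Finset V).biUnion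
        fun u => (distBall G h u).image fun v => (u, v) := by
      rintro ⟨u, v⟩ hp
      simp only [hB, Finset.mem_filter, Finset.mem_univ, true_and] at hp
      simp [hp]
    exact (Finset.card_le_card hsub).trans (Finset.card_biUnion_le_card_mul _ _ _
      fun u _ => Finset.card_image_le.trans (card_distBall_le hG.degree_le h u))
  have hsub : (joinablePairs G h Δ)ᶜ ⊆
      ((D ×ˢ Finset.univ) ∪ (Finset.univ ×ˢ D)) ∪ (B ∪ B.image Prod.swap) := by
    rintro ⟨u, v⟩ hp
    simp only [joinablePairs, Finset.mem_compl, Finset.mem_filter, Finset.mem_univ, true_and] at hp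
    simp only [hD, hB, Finset.mem_union, Finset.mem_product, Finset.mem_filter, Finset.mem_univ,
      true_and, and_true, Finset.mem_image, Prod.exists, Prod.swap_prod_mk, Prod.mk.injEq]
    by_contra hcon
    push Not at hcon
    exact hp ⟨hcon.1.1, hcon.1.2, hcon.2.1, fun hm => hcon.2.2 v u hm rfl rfl⟩
  have h1 := Finset.card_le_card hsub
  have h2 := Finset.card_union_le ((D ×ˢ Finset.univ) ∪ (Finset.univ ×ˢ D)) (B ∪ B.image Prod.swap)
  have h3 := Finset.card_union_le (D ×ˢ (Finset.univ : Finset V)) (Finset.univ ×ˢ D)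
  have h4 := Finset.card_union_le B (B.image Prod.swap)
  have h5 : (B.image Prod.swap).card ≤ B.card := Finset.card_image_le
  have h6 : D.card * Fintype.card V ≤ b * Fintype.card V := Nat.mul_le_mul_right _ hDcard
  rw [Finset.card_product, Finset.card_product, Finset.card_univ, mul_comm (Fintype.card V)] at h3
  lia

open scoped Classical in
/-- If few pairs are not joinable, some new edge destroys a fixed proportion of the
independent sets with `k` vertices while keeping the graph sparse. -/
theorem IsSparse.exists_step {V : Type*} [Fintype V] {G : SimpleGraph V} {h Δ t k q : ℕ}
    (hG : IsSparse G h Δ t) (hh : 1 ≤ h) (hk : 0 < k) (hV : Fintype.card V = q * k)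
    (hbad : 2 * (joinablePairs G h Δ)ᶜ.card ≤ k ^ 2) :
    ∃ G' : SimpleGraph V, IsSparse G' h Δ (t + 1) ∧
      2 * q ^ 2 * (indepSetsOfCard G' k).card + (indepSetsOfCard G k).card ≤
        2 * q ^ 2 * (indepSetsOfCard G k).card := by
  set A := indepSetsOfCard G k with hA
  rcases A.eq_empty_or_nonempty with hempty | hne
  · refine ⟨G, ⟨hG.noShortCycle, hG.degree_le, hG.card_edges_le.trans (Nat.le_succ t)⟩, ?_⟩
    rw [← hA, hempty]
    simp
  have hmany : ∀ S ∈ A, k ^ 2 ≤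
      2 * ((joinablePairs G h Δ).filter fun p => p.1 ∈ S ∧ p.2 ∈ S).card := by
    intro S hS
    simp only [hA, indepSetsOfCard, Finset.mem_filter, Finset.mem_univ, true_and] at hS
    have hcov : S ×ˢ S ⊆ ((joinablePairs G h Δ).filter fun p => p.1 ∈ S ∧ p.2 ∈ S) ∪
        (joinablePairs G h Δ)ᶜ := by
      intro p hp
      rw [Finset.mem_product] at hp
      rw [Finset.mem_union, Finset.mem_filter, Finset.mem_compl]
      tauto
    have h1 := (Finset.card_le_card hcov).trans (Finset.card_union_le _ _)
    rw [Finset.card_product, hS.1, ← sq] at h1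
    lia
  obtain ⟨⟨u, v⟩, hp, hcount⟩ := exists_pair_mem_many (by positivity) hne hmany
  obtain ⟨huv, hsparse⟩ := hG.sup_edge hh hp
  refine ⟨G ⊔ edge u v, hsparse, ?_⟩
  have hdrop := card_indepSetsOfCard_sup_edge G k huv
  rw [← hA] at hdrop
  rw [hV] at hcount
  have hcount' : A.card ≤ 2 * q ^ 2 * (A.filter fun S => u ∈ S ∧ v ∈ S).card := by
    refine le_of_mul_le_mul_left (a := k ^ 2) (hcount.trans_eq ?_) (by positivity)
    ring
  calc _ ≤ 2 * q ^ 2 * (indepSetsOfCard (G ⊔ edge u v) k).card +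
        2 * q ^ 2 * (A.filter fun S => u ∈ S ∧ v ∈ S).card := Nat.add_le_add_left hcount' _
    _ = 2 * q ^ 2 * ((indepSetsOfCard (G ⊔ edge u v) k).card +
        (A.filter fun S => u ∈ S ∧ v ∈ S).card) := by ring
    _ ≤ _ := Nat.mul_le_mul_left _ hdrop

/-- There are graphs without short cycles on `q * k` vertices having no independent set with
`k` vertices. -/
theorem exists_noShortCycle_indepSetsOfCard_eq_empty (h q : ℕ) (hh : 1 ≤ h) (hq : 1 ≤ q) :
    ∃ k : ℕ, 0 < k ∧ ∃ G : SimpleGraph (Fin (q * k)),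
      NoShortCycle G h ∧ indepSetsOfCard G k = ∅ := by
  classical
  have hq0 : (0 : ℝ) < 2 * (q : ℝ) ^ 2 := by positivity
  set δ : ℝ := 1 - 1 / (2 * (q : ℝ) ^ 2) with hδ
  have hδ1 : δ < 1 := by
    rw [hδ]
    have : 0 < 1 / (2 * (q : ℝ) ^ 2) := by positivity
    linarith
  have hδ0 : 0 ≤ δ := by
    rw [hδ, sub_nonneg, div_le_one hq0]
    have : (1 : ℝ) ≤ (q : ℝ) := by exact_mod_cast hq
    nlinarith
  obtain ⟨D, hD⟩ := exists_pow_lt_of_lt_one (show (0 : ℝ) < 1 / 4 by norm_num) hδ1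
  set Δ : ℕ := 16 * (D + 1) * q ^ 2 with hΔ
  set k : ℕ := 8 * q * (Δ + 1) ^ h with hk
  have hkpos : 0 < k := by positivity
  have hΔpos : 0 < Δ := by positivity
  have hstage : ∀ t : ℕ, t ≤ D * (q * k) → ∃ G : SimpleGraph (Fin (q * k)),
      IsSparse G h Δ t ∧ ((indepSetsOfCard G k).card : ℝ) ≤ δ ^ t * 2 ^ (q * k) := by
    intro t
    induction t with
    | zero =>
      intro _
      refine ⟨⊥, ⟨?_, ?_, ?_⟩, ?_⟩
      · intro m _ _ f _ hadj
        exact hadj 0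
      · intro v
        simp
      · simp
      · rw [pow_zero, one_mul]
        have := Finset.card_le_univ (indepSetsOfCard (⊥ : SimpleGraph (Fin (q * k))) k)
        rw [Fintype.card_finset, Fintype.card_fin] at this
        exact_mod_cast this
    | succ t ih =>
      intro ht
      obtain ⟨G, hG, hcard⟩ := ih (by lia)
      obtain ⟨G', hG', hdrop⟩ := hG.exists_step hh hkpos (Fintype.card_fin (q * k)) (by
        have hb : 2 * t ≤ (Δ + 1) ^ h * Δ := by
          calc 2 * t ≤ 2 * (D * (q * k)) := Nat.mul_le_mul_left 2 (by lia)
            _ = (Δ + 1) ^ h * (16 * D * q ^ 2) := by rw [hk]; ring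
            _ ≤ (Δ + 1) ^ h * Δ := by
              rw [hΔ]
              gcongr
              exact Nat.le_succ D
        refine (Nat.mul_le_mul_left 2 (hG.card_not_joinable_le hb hΔpos)).trans_eq ?_
        rw [Fintype.card_fin, sq]
        nth_rw 4 [hk]
        ring)
      refine ⟨G', hG', ?_⟩
      have hdrop' : 2 * (q : ℝ) ^ 2 * (indepSetsOfCard G' k).card +
          (indepSetsOfCard G k).card ≤ 2 * (q : ℝ) ^ 2 * (indepSetsOfCard G k).card := by
        exact_mod_cast hdrop
      have hle : ((indepSetsOfCard G' k).card : ℝ) ≤ δ * (indepSetsOfCard G k).card := by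
        refine le_of_mul_le_mul_left ?_ hq0
        have : 2 * (q : ℝ) ^ 2 * δ = 2 * (q : ℝ) ^ 2 - 1 := by
          rw [hδ]
          field_simp
        rw [← mul_assoc (2 * (q : ℝ) ^ 2) δ, this]
        linarith
      calc _ ≤ _ := hle
        _ ≤ δ * (δ ^ t * 2 ^ (q * k)) := mul_le_mul_of_nonneg_left hcard hδ0
        _ = _ := by ring
  obtain ⟨G, hG, hcard⟩ := hstage _ le_rfl
  refine ⟨k, hkpos, G, hG.noShortCycle, ?_⟩
  rw [← Finset.card_eq_zero]
  have hlt : δ ^ (D * (q * k)) * 2 ^ (q * k) < 1 := by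
    rw [pow_mul, ← mul_pow]
    have : 0 ≤ δ ^ D := pow_nonneg hδ0 D
    exact pow_lt_one₀ (by positivity) (by linarith) (by positivity)
  have : ((indepSetsOfCard G k).card : ℝ) < 1 := hcard.trans_lt hlt
  have : (indepSetsOfCard G k).card < 1 := by exact_mod_cast this
  lia

/-- A cycle of length at most `h` in the complement of `H` keeps `H` from being an induced
subgraph of the complement of a graph without short cycles. -/
theorem NoShortCycle.indFree_compl {V W : Type*} {G : SimpleGraph V} {H : SimpleGraph W}
    {h m : ℕ} (hG : NoShortCycle G h) (hm : 3 ≤ m) (hmh : m ≤ h)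
    (hH : ¬ IndFree (cycleGraph m) Hᶜ) : IndFree H Gᶜ := by
  rintro s ⟨e⟩
  simp only [IndFree, not_forall, not_not] at hH
  obtain ⟨r, ⟨c⟩⟩ := hH
  obtain ⟨m, rfl⟩ : ∃ m', m = m' + 2 := ⟨m - 2, by lia⟩
  refine hG (m + 1) (by lia) (by lia) (fun i => (e (c i).1).1) ?_ fun i => ?_
  · intro i j hij
    exact c.injective (Subtype.ext (e.injective (Subtype.ext hij)))
  · have hadj : (cycleGraph (m + 2)).Adj i (i + 1) := by
      rw [cycleGraph_adj]
      right
      simp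
    have hc : Hᶜ.Adj (c i).1 (c (i + 1)).1 := c.map_adj_iff.2 hadj
    rw [compl_adj] at hc
    have he : ¬ Gᶜ.Adj (e (c i).1).1 (e (c (i + 1)).1).1 := fun hcon =>
      hc.2 (e.map_adj_iff.1 hcon)
    rw [compl_adj, not_and, not_not] at he
    exact he fun heq => hc.1 (e.injective (Subtype.ext heq))

theorem NoShortCycle.cliqueFree_three {V : Type*} {G : SimpleGraph V} {h : ℕ}
    (hG : NoShortCycle G h) (hh : 3 ≤ h) : G.CliqueFree 3 := by
  classical
  intro s hs
  obtain ⟨a, b, c, hab, hac, hbc, -⟩ := is3Clique_iff.1 hs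
  refine hG 2 le_rfl hh ![a, b, c] ?_ ?_
  · intro i j hij
    fin_cases i <;> fin_cases j <;>
      simp_all [hab.ne, hac.ne, hbc.ne, hab.ne', hac.ne', hbc.ne']
  · intro i
    fin_cases i
    · exact hab
    · exact hbc
    · exact hac.symm

/-- Colour classes of the complement of a triangle-free graph have at most two vertices. -/
theorem card_le_two_mul_chromaticNumber_compl {V : Type*} [Fintype V]
    {G : SimpleGraph V} (hG : G.CliqueFree 3) :
    Fintype.card V ≤ 2 * Gᶜ.chromaticNumber.toNat := by
  classical
  obtain ⟨C⟩ := colorable_chromaticNumber_of_fintype Gᶜ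
  have hle := Finset.card_le_mul_card_image (f := fun x => C x) (Finset.univ : Finset V) 2 fun b _ => by
    by_contra! hlt
    obtain ⟨t, ht, htc⟩ := Finset.exists_subset_card_eq hlt
    refine hG t ⟨fun x hx y hy hxy => ?_, htc⟩
    by_contra hnadj
    have hx' := (Finset.mem_filter.1 (ht hx)).2
    have hy' := (Finset.mem_filter.1 (ht hy)).2
    exact C.valid ((compl_adj ..).2 ⟨hxy, hnadj⟩) (hx'.trans hy'.symm)
  have himg := Finset.card_le_univ ((Finset.univ : Finset V).image fun x => C x)
  rw [Fintype.card_fin] at himg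
  rw [Finset.card_univ] at hle
  lia

theorem cliqueNum_compl_le {V : Type*} [Fintype V] {G : SimpleGraph V} {k : ℕ}
    (hG : indepSetsOfCard G k = ∅) : Gᶜ.cliqueNum ≤ k := by
  classical
  by_contra! hlt
  obtain ⟨s, hs⟩ := Gᶜ.exists_isNClique_cliqueNum
  obtain ⟨t, ht, htc⟩ := Finset.exists_subset_card_eq (hlt.le.trans hs.card_eq.ge)
  have hmem : t ∈ indepSetsOfCard G k := by
    simp only [indepSetsOfCard, Finset.mem_filter, Finset.mem_univ, true_and]
    exact ⟨htc, (isClique_compl G).1 (hs.isClique.subset (by exact_mod_cast ht))⟩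
  simp [hG] at hmem

/-- If every `H ∈ ℋ` is such that the complement of `H` contains an induced cycle of
length at most `h`, then for every `c > 0` there is a finite nonempty `ℋ`-free graph
`G` with `χ(G) > c · ω(G)`; in particular there is no linear `χ`-binding function for
the class of `ℋ`-free graphs. -/
theorem stmt10 (ℋ : Set (Σ n : ℕ, SimpleGraph (Fin n))) (h : ℕ)
    (hH : ∀ H ∈ ℋ, ∃ m : ℕ, 3 ≤ m ∧ m ≤ h ∧ ¬ IndFree (cycleGraph m) (H.2)ᶜ)
    (c : ℝ) (hc : 0 < c) :
    ∃ (n : ℕ) (G : SimpleGraph (Fin n)), 0 < n ∧ (∀ H ∈ ℋ, IndFree H.2 G) ∧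
      c * (G.cliqueNum : ℝ) < (G.chromaticNumber.toNat : ℝ) := by
  obtain ⟨q, hq⟩ := exists_nat_gt (2 * c)
  have hq1 : 1 ≤ q := by
    have : (0 : ℝ) < q := by linarith
    exact_mod_cast this
  obtain ⟨k, hk, G, hG, hindep⟩ :=
    exists_noShortCycle_indepSetsOfCard_eq_empty (max h 3) q (by lia) hq1
  refine ⟨q * k, Gᶜ, by positivity, fun H hmem => ?_, ?_⟩
  · obtain ⟨m, hm, hmh, hcyc⟩ := hH H hmem
    exact hG.indFree_compl hm (hmh.trans (le_max_left h 3)) hcyc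
  · have hω : (Gᶜ.cliqueNum : ℝ) ≤ k := by exact_mod_cast cliqueNum_compl_le hindep
    have hχ := card_le_two_mul_chromaticNumber_compl
      (hG.cliqueFree_three (le_max_right h 3))
    rw [Fintype.card_fin] at hχ
    have hχ' : (q : ℝ) * k ≤ 2 * Gᶜ.chromaticNumber.toNat := by exact_mod_cast hχ
    have hk' : (0 : ℝ) < k := by exact_mod_cast hk
    nlinarith [mul_le_mul_of_nonneg_left hω hc.le, mul_lt_mul_of_pos_right hq hk']
end

section
/- If G is a finite critical Q(P4)-free graph, then there is a positive integer k and a partition of V(G) into nonempty sets M1, …, Mk such that every vertex of Mi is adjacent to every vertex of Mj for all distinct i, j, and for each i the subgraph induced by Mi is a 'non-empty, 2K1-free'-expansion of a prime graph that has no clique-separator of modules. -/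
open SimpleGraph

/-- The subgraph induced by `S` has a proper colouring with colours below `n`. -/
def ColorableOn {V : Type*} (G : SimpleGraph V) (S : Set V) (n : ℕ) : Prop :=
  ∃ c : V → ℕ, (∀ x ∈ S, c x < n) ∧ ∀ x ∈ S, ∀ y ∈ S, G.Adj x y → c x ≠ c y

/-- `G` is not `n`-colourable, but deleting any vertex makes it so. -/
def IsCriticalAt {V : Type*} (G : SimpleGraph V) (n : ℕ) : Prop :=
  ¬ ColorableOn G Set.univ n ∧ ∀ v, ColorableOn G {v}ᶜ n

/-- `S` is the disjoint union of two nonempty sets with no edge between them. -/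
def SplitsAnticomplete {V : Type*} (G : SimpleGraph V) (S : Set V) : Prop :=
  ∃ A B : Set V, A.Nonempty ∧ B.Nonempty ∧ Disjoint A B ∧ A ∪ B = S ∧
    ∀ a ∈ A, ∀ b ∈ B, ¬ G.Adj a b

/-- `S` is the disjoint union of two nonempty sets with all edges between them. -/
def SplitsComplete {V : Type*} (G : SimpleGraph V) (S : Set V) : Prop :=
  ∃ A B : Set V, A.Nonempty ∧ B.Nonempty ∧ Disjoint A B ∧ A ∪ B = S ∧
    ∀ a ∈ A, ∀ b ∈ B, G.Adj a b

/-- No four vertices of `S` induce a path. -/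
def P4FreeOn {V : Type*} (G : SimpleGraph V) (S : Set V) : Prop :=
  ∀ a ∈ S, ∀ b ∈ S, ∀ c ∈ S, ∀ d ∈ S, G.Adj a b → G.Adj b c → G.Adj c d →
    a ≠ c → a ≠ d → b ≠ d → ¬ G.Adj a c → ¬ G.Adj a d → ¬ G.Adj b d → False

section Coloring

variable {V : Type*} {G : SimpleGraph V}

lemma ColorableOn.mono {S T : Set V} {m n : ℕ} (h : ColorableOn G T m) (hST : S ⊆ T)
    (hmn : m ≤ n) : ColorableOn G S n := by
  obtain ⟨c, hc, hp⟩ := h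
  exact ⟨c, fun x hx => (hc x (hST hx)).trans_le hmn,
    fun x hx y hy => hp x (hST hx) y (hST hy)⟩

lemma colorable_induce_iff {S : Set V} {n : ℕ} :
    (G.induce S).Colorable n ↔ ColorableOn G S n := by
  classical
  rw [colorable_iff_exists_bdd_nat_coloring]
  constructor
  · rintro ⟨c, hc⟩
    refine ⟨fun x => if h : x ∈ S then c ⟨x, h⟩ else 0, fun x hx => ?_, fun x hx y hy h => ?_⟩
    · simpa [hx] using hc ⟨x, hx⟩
    · simpa [hx, hy] using c.valid (v := ⟨x, hx⟩) (w := ⟨y, hy⟩) h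
  · rintro ⟨c, hc, hp⟩
    exact ⟨Coloring.mk (fun x => c x) fun {x y} h => hp x x.2 y y.2 h, fun x => hc x x.2⟩

lemma colorable_iff_colorableOn_univ {n : ℕ} : G.Colorable n ↔ ColorableOn G Set.univ n := by
  rw [colorable_iff_exists_bdd_nat_coloring]
  constructor
  · rintro ⟨c, hc⟩
    exact ⟨c, fun x _ => hc x, fun x _ y _ h => c.valid h⟩
  · rintro ⟨c, hc, hp⟩
    exact ⟨Coloring.mk c fun {x y} h => hp x trivial y trivial h, fun x => hc x trivial⟩

lemma colorableOn_induce_iff {C : Set V} {S : Set C} {n : ℕ} :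
    ColorableOn (G.induce C) S n ↔ ColorableOn G (Subtype.val '' S) n := by
  classical
  constructor
  · rintro ⟨c, hc, hp⟩
    refine ⟨fun x => if h : x ∈ C then c ⟨x, h⟩ else 0, ?_, ?_⟩
    · rintro _ ⟨x, hx, rfl⟩
      simpa using hc x hx
    · rintro _ ⟨x, hx, rfl⟩ _ ⟨y, hy, rfl⟩ h
      simpa using hp x hx y hy h
  · rintro ⟨c, hc, hp⟩
    exact ⟨fun x => c x, fun x hx => hc _ ⟨x, hx, rfl⟩,
      fun x hx y hy h => hp _ ⟨x, hx, rfl⟩ _ ⟨y, hy, rfl⟩ h⟩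

lemma exists_colorableOn [Finite V] (G : SimpleGraph V) (S : Set V) : ∃ n, ColorableOn G S n := by
  have := Fintype.ofFinite V
  exact ⟨_, (colorable_iff_colorableOn_univ.1 G.colorable_of_fintype).mono
    (Set.subset_univ S) le_rfl⟩

lemma IsCritical.exists_isCriticalAt [Finite V] (h : IsCritical G) : ∃ n, IsCriticalAt G n := by
  obtain ⟨⟨v⟩, h⟩ := h
  have htop : G.chromaticNumber ≠ ⊤ := by
    obtain ⟨n, hn⟩ := exists_colorableOn G Set.univ
    exact chromaticNumber_ne_top_iff_exists.2 ⟨n, colorable_iff_colorableOn_univ.2 hn⟩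
  obtain ⟨m, hm⟩ := ENat.ne_top_iff_exists.1 htop
  rw [← hm] at h
  obtain _ | n := m
  · exact absurd (h v) (by simp)
  refine ⟨n, fun hn => ?_, fun v => ?_⟩
  · have := chromaticNumber_le_iff_colorable.2 (colorable_iff_colorableOn_univ.2 hn)
    rw [← hm] at this
    exact absurd (by exact_mod_cast this) (Nat.not_succ_le_self n)
  · refine colorable_induce_iff.1 (chromaticNumber_le_iff_colorable.1 ?_)
    have := h v
    push_cast at this
    exact (ENat.lt_add_one_iff (ENat.natCast_ne_top n)).1 this

/-- The colours appearing on a set suffice to colour it. -/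
lemma colorableOn_ncard_image [Finite V] {S : Set V} {α : Type*} (c : V → α)
    (hp : ∀ x ∈ S, ∀ y ∈ S, G.Adj x y → c x ≠ c y) : ColorableOn G S (c '' S).ncard := by
  classical
  let e := Finite.equivFin (c '' S)
  refine ⟨fun x => if h : x ∈ S then e ⟨c x, x, h, rfl⟩ else 0, fun x hx => ?_,
    fun x hx y hy h => ?_⟩
  · simp only [hx, dif_pos]
    exact (e _).2
  · simp only [hx, hy, dif_pos]
    intro he
    have := congrArg Subtype.val (e.injective (Fin.ext he))
    exact hp x hx y hy h this

/-- A module can be recoloured with the colours it already uses. -/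
lemma ColorableOn.recolor_module [Finite V] {S M : Set V} (hM : IsModule G M) {c : V → ℕ} {n : ℕ}
    (hc : ∀ x ∈ S, c x < n) (hp : ∀ x ∈ S, ∀ y ∈ S, G.Adj x y → c x ≠ c y)
    (h : ColorableOn G M (c '' (M ∩ S)).ncard) : ColorableOn G (S ∪ M) n := by
  classical
  obtain ⟨d, hd, hdp⟩ := h
  let e : Fin (c '' (M ∩ S)).ncard ≃ (c '' (M ∩ S)) := (Finite.equivFin (c '' (M ∩ S))).symm
  have key : ∀ x ∈ S, x ∉ M → ∀ y ∈ M, G.Adj x y → ∀ i, c x ≠ e i := by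
    intro x hx hxM y hy hxy i
    obtain ⟨z, ⟨hzM, hzS⟩, hz⟩ := (e i).2
    rw [← hz]
    refine hp x hx z hzS ?_
    rcases hM.2 x hxM with h | h
    · exact h z hzM
    · exact absurd hxy (h y hy)
  refine ⟨fun x => if h : x ∈ M then e ⟨d x, hd x h⟩ else c x, fun x hx => ?_, ?_⟩
  · by_cases hxM : x ∈ M
    · simp only [hxM, dif_pos]
      obtain ⟨z, ⟨-, hzS⟩, hz⟩ := (e ⟨d x, hd x hxM⟩).2
      rw [← hz]
      exact hc z hzS
    · simpa [hxM] using hc x (hx.resolve_right hxM)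
  · intro x hx y hy hxy
    by_cases hxM : x ∈ M <;> by_cases hyM : y ∈ M <;> simp only [hxM, hyM, dif_pos, dif_neg,
      not_false_eq_true]
    · intro he
      have := congrArg Fin.val (e.injective (Subtype.ext he))
      exact hdp x hxM y hyM hxy this
    · exact (key y (hy.resolve_right hyM) hyM x hxM hxy.symm _).symm
    · exact key x (hx.resolve_right hxM) hxM y hyM hxy _
    · exact hp x (hx.resolve_right hxM) y (hy.resolve_right hyM) hxy

/-- In a critical graph, a part of a complete join induces a critical graph. -/
lemma IsCriticalAt.induce_of_join [Finite V] {n : ℕ} (hG : IsCriticalAt G n) {C : Set V}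
    (hne : C.Nonempty) (hC : ∀ x ∈ C, ∀ y ∉ C, G.Adj x y) :
    ∃ m, IsCriticalAt (G.induce C) m := by
  classical
  have hex := exists_colorableOn G C
  have hpos : 0 < Nat.find hex := by
    obtain ⟨v, hv⟩ := hne
    obtain ⟨c, hc, -⟩ := Nat.find_spec hex
    exact (Nat.zero_le _).trans_lt (hc v hv)
  refine ⟨Nat.find hex - 1, fun h => ?_, fun v => ?_⟩
  · rw [colorableOn_induce_iff, Subtype.coe_image_univ] at h
    exact Nat.find_min hex (by omega) h
  · obtain ⟨c, hc, hp⟩ := hG.2 v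
    have hlt : (c '' (C ∩ {v.1}ᶜ)).ncard < Nat.find hex := by
      by_contra! hle
      refine hG.1 ((ColorableOn.recolor_module (M := C) ⟨hne, fun x hx =>
        Or.inl fun u hu => (hC u hu x hx).symm⟩ hc hp
        ((Nat.find_spec hex).mono subset_rfl hle)).mono ?_ le_rfl)
      intro x _
      by_cases hx : x = v
      · exact Or.inr (hx ▸ v.2)
      · exact Or.inl hx
    rw [colorableOn_induce_iff]
    refine (colorableOn_ncard_image (S := C ∩ {v.1}ᶜ) c
      fun x hx y hy => hp x hx.2 y hy.2).mono ?_ (by omega)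
    rintro _ ⟨x, hx, rfl⟩
    exact ⟨x.2, fun h => hx (Subtype.ext h)⟩

lemma colorableOn_total (G : SimpleGraph V) (A B : Set V) :
    (∀ n, ColorableOn G A n → ColorableOn G B n) ∨
      (∀ n, ColorableOn G B n → ColorableOn G A n) := by
  by_contra! h
  obtain ⟨⟨m, hA, hB⟩, n, hB', hA'⟩ := h
  rcases le_total m n with hmn | hmn
  · exact hA' (hA.mono subset_rfl hmn)
  · exact hB (hB'.mono subset_rfl hmn)

lemma ColorableOn.union_of_anticomplete {A B : Set V} {n : ℕ} (hA : ColorableOn G A n)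
    (hB : ColorableOn G B n) (h : ∀ a ∈ A, ∀ b ∈ B, ¬ G.Adj a b) :
    ColorableOn G (A ∪ B) n := by
  classical
  obtain ⟨c, hc, hcp⟩ := hA
  obtain ⟨d, hd, hdp⟩ := hB
  refine ⟨fun x => if x ∈ A then c x else d x, fun x hx => ?_, fun x hx y hy hxy => ?_⟩
  · by_cases hxA : x ∈ A
    · simpa [hxA] using hc x hxA
    · simpa [hxA] using hd x (hx.resolve_left hxA)
  · by_cases hxA : x ∈ A <;> by_cases hyA : y ∈ A <;> simp only [hxA, hyA, if_true, if_false]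
    · exact hcp x hxA y hyA hxy
    · exact absurd hxy (h x hxA y (hy.resolve_left hyA))
    · exact absurd hxy.symm (h y hyA x (hx.resolve_left hxA))
    · exact hdp x (hx.resolve_left hxA) y (hy.resolve_left hyA) hxy

/-- In a critical graph every module is connected. -/
lemma IsCriticalAt.not_splitsAnticomplete [Finite V] {n : ℕ} (hG : IsCriticalAt G n) {M : Set V}
    (hM : IsModule G M) : ¬ SplitsAnticomplete G M := by
  rintro ⟨A, B, hA, hB, hdis, hAB, hanti⟩
  wlog hle : ∀ n, ColorableOn G A n → ColorableOn G B n generalizing A B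
  · exact this B A hB hA hdis.symm (Set.union_comm A B ▸ hAB)
      (fun b hb a ha h => hanti a ha b hb h.symm)
      ((colorableOn_total G A B).resolve_left hle)
  obtain ⟨b, hb⟩ := hB
  have hsub : Bᶜ ⊆ {b}ᶜ := fun x hx hxb => hx (Set.mem_singleton_iff.1 hxb ▸ hb)
  obtain ⟨c, hc, hp⟩ := (hG.2 b).mono hsub le_rfl
  have hAeq : M ∩ Bᶜ = A := by
    rw [← hAB]
    ext x
    have : x ∈ A → x ∉ B := fun h => Set.disjoint_left.1 hdis h
    simp only [Set.mem_inter_iff, Set.mem_union, Set.mem_compl_iff]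
    tauto
  have hAB' := Set.disjoint_left.1 hdis
  have hcol := colorableOn_ncard_image (S := A) c
    fun x hx y hy => hp x (hAB' hx) y (hAB' hy)
  refine hG.1 ((ColorableOn.recolor_module hM hc hp ?_).mono ?_ le_rfl)
  · rw [hAeq, ← hAB]
    exact hcol.union_of_anticomplete (hle _ hcol) hanti
  · intro x _
    by_cases hx : x ∈ B
    · exact Or.inr (hAB ▸ Or.inr hx)
    · exact Or.inl hx

/-- A proper colouring uses at least as many colours on each set as are necessary. -/
lemma exists_embedding_image [Finite V] {S : Set V} {α : Type*} (c : V → α)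
    (hp : ∀ x ∈ S, ∀ y ∈ S, G.Adj x y → c x ≠ c y) {m : ℕ}
    (hm : ∀ k < m, ¬ ColorableOn G S k) : ∃ e : Fin m → α, Function.Injective e ∧
      ∀ i, e i ∈ c '' S := by
  classical
  obtain ⟨g⟩ : Nonempty (Fin m ↪ (c '' S)) := by
    have := Fintype.ofFinite (c '' S)
    refine Function.Embedding.nonempty_of_card_le ?_
    rw [Fintype.card_fin, ← Nat.card_eq_fintype_card]
    by_contra! hlt
    exact hm _ hlt (colorableOn_ncard_image c hp)
  exact ⟨fun i => g i, Subtype.val_injective.comp g.injective, fun i => (g i).2⟩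

/-- Colourings of pairwise complete sets use disjoint colour sets, so the embeddings of
`exists_embedding_image` for these sets combine to an injection. -/
lemma exists_sigma_embedding_image [Finite V] {ι : Type*} {X : ι → Set V} {S : Set V}
    (hXS : ∀ i, X i ⊆ S)
    (hX : ∀ i j, i ≠ j → ∀ u ∈ X i, ∀ v ∈ X j, G.Adj u v) {α : Type*} (c : V → α)
    (hp : ∀ x ∈ S, ∀ y ∈ S, G.Adj x y → c x ≠ c y) {m : ι → ℕ}
    (hm : ∀ i, ∀ k < m i, ¬ ColorableOn G (X i) k) :
    ∃ e : (Σ i, Fin (m i)) → α, Function.Injective e ∧ ∀ t, e t ∈ c '' X t.1 := by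
  choose e he heX using fun i => exists_embedding_image c
    (fun x hx y hy => hp x (hXS i hx) y (hXS i hy)) (hm i)
  refine ⟨fun t => e t.1 t.2, ?_, fun t => heX t.1 t.2⟩
  rintro ⟨i, a⟩ ⟨j, b⟩ hab
  by_cases hij : i = j
  · subst hij
    exact congrArg (Sigma.mk i) (he i hab)
  · obtain ⟨x, hx, hxe⟩ := heX i a
    obtain ⟨y, hy, hye⟩ := heX j b
    exact absurd (hxe.trans (hab.trans hye.symm))
      (hp x (hXS i hx) y (hXS j hy) (hX i j hij x hx y hy))

/-- A critical graph has no clique-separator of modules. -/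
lemma IsCriticalAt.not_isCliqueSeparatorOfModules [Finite V] {n : ℕ} (hG : IsCriticalAt G n)
    (X : Set V) : ¬ IsCliqueSeparatorOfModules G X := by
  classical
  rintro ⟨⟨k, Xs, hmod, hdis, hadj, hX⟩, A, B, hAB, ⟨a, ha⟩, ⟨b, hb⟩, hanti, hABX⟩
  have hn : NeZero n := by
    obtain ⟨c, hc, -⟩ := hG.2 b
    refine ⟨fun h => ?_⟩
    have := hc a (by rintro rfl; exact ha.2 hb.1)
    omega
  have key : ∀ (S : Set V) (v : V), v ∉ S → ∃ c : V → Fin n,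
      ∀ x ∈ S, ∀ y ∈ S, G.Adj x y → c x ≠ c y := by
    intro S v hv
    obtain ⟨c, hc, hp⟩ := hG.2 v
    have hS : ∀ x ∈ S, x ∈ ({v}ᶜ : Set V) := fun x hx h => hv (Set.mem_singleton_iff.1 h ▸ hx)
    refine ⟨fun x => Fin.ofNat n (c x), fun x hx y hy h he => ?_⟩
    have he := congrArg Fin.val he
    simp only [Fin.val_ofNat, Nat.mod_eq_of_lt (hc x (hS x hx)),
      Nat.mod_eq_of_lt (hc y (hS y hy))] at he
    exact hp x (hS x hx) y (hS y hy) h he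
  obtain ⟨c, hc⟩ := key A b hb.2
  obtain ⟨d, hd⟩ := key B a ha.2
  have hXAB : ∀ i, Xs i ⊆ A ∩ B := fun i => hABX ▸ hX ▸ Set.subset_iUnion Xs i
  have hex := fun i => exists_colorableOn G (Xs i)
  obtain ⟨e, he, heX⟩ := exists_sigma_embedding_image
    (fun i => (hXAB i).trans Set.inter_subset_left) hadj c hc
    (fun i k hk => Nat.find_min (hex i) hk)
  obtain ⟨f, hf, hfX⟩ := exists_sigma_embedding_image
    (fun i => (hXAB i).trans Set.inter_subset_right) hadj d hd
    (fun i k hk => Nat.find_min (hex i) hk)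
  obtain ⟨σ, hσ⟩ := Equiv.Perm.exists_extending_pair f e hf he
  have hspec := fun i => Nat.find_spec (hex i)
  choose h hlt hproper using hspec
  have hmem : ∀ x, x ∈ A ∩ B → ∃ i, x ∈ Xs i := by
    intro x hx
    rw [hABX, hX] at hx
    exact Set.mem_iUnion.1 hx
  choose idx hidx using hmem
  let col : V → Fin n := fun x =>
    if hx : x ∈ A ∩ B then e ⟨idx x hx, h _ x, hlt _ x (hidx x hx)⟩
    else if x ∈ A then c x else σ (d x)
  have hall : ∀ i, ∀ x ∉ A ∩ B, ∀ y ∈ Xs i, G.Adj x y → ∀ z ∈ Xs i, G.Adj x z := by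
    intro i x hx y hy hxy
    rcases (hmod i).2 x (fun hxi => hx (hXAB i hxi)) with h | h
    · exact h
    · exact absurd hxy (h y hy)
  have hcross : ∀ x ∉ A ∩ B, ∀ y ∈ A ∩ B, G.Adj x y → col x ≠ col y := by
    intro x hx y hy hxy heq
    by_cases hxA : x ∈ A
    · simp only [col, hx, hy, hxA, dif_pos, dif_neg, if_true, not_false_eq_true] at heq
      obtain ⟨z, hz, hze⟩ := heX ⟨idx y hy, h _ y, hlt _ y (hidx y hy)⟩
      exact hc x hxA z (hXAB _ hz).1 (hall _ x hx y (hidx y hy) hxy z hz) (heq.trans hze.symm)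
    · have hxB : x ∈ B := (hAB ▸ Set.mem_univ x : x ∈ A ∪ B).resolve_left hxA
      simp only [col, hx, hy, hxA, dif_pos, dif_neg, if_false, not_false_eq_true] at heq
      obtain ⟨z, hz, hze⟩ := hfX ⟨idx y hy, h _ y, hlt _ y (hidx y hy)⟩
      refine hd x hxB z (hXAB _ hz).2 (hall _ x hx y (hidx y hy) hxy z hz) (σ.injective ?_)
      rw [heq, hze, ← hσ]
  refine hG.1 ⟨fun x => col x, fun x _ => (col x).2, fun x _ y _ hxy heq => ?_⟩
  replace heq : col x = col y := Fin.ext heq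
  by_cases hx : x ∈ A ∩ B <;> by_cases hy : y ∈ A ∩ B
  · simp only [col, hx, hy, dif_pos] at heq
    have heq := he heq
    by_cases hij : idx x hx = idx y hy
    · have h1 := hidx x hx
      rw [hij] at h1
      refine hproper _ x h1 y (hidx y hy) hxy ?_
      rw [Sigma.mk.injEq] at heq
      have h2 := (Fin.heq_ext_iff (by rw [hij])).1 heq.2
      simpa only [hij] using h2
    · exact hij (congrArg Sigma.fst heq)
  · exact hcross y hy x hx hxy.symm heq.symm
  · exact hcross x hx y hy hxy heq
  · have hx' : x ∈ A ∪ B := hAB ▸ Set.mem_univ x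
    have hy' : y ∈ A ∪ B := hAB ▸ Set.mem_univ y
    by_cases hxA : x ∈ A <;> by_cases hyA : y ∈ A
    · simp only [col, hx, hy, hxA, hyA, dif_neg, if_true, not_false_eq_true] at heq
      exact hc x hxA y hyA hxy heq
    · exact hanti x ⟨hxA, fun h => hx ⟨hxA, h⟩⟩ y ⟨hy'.resolve_left hyA, hyA⟩ hxy
    · exact hanti y ⟨hyA, fun h => hy ⟨hyA, h⟩⟩ x ⟨hx'.resolve_left hxA, hxA⟩ hxy.symm
    · simp only [col, hx, hy, hxA, hyA, dif_neg, if_false, not_false_eq_true] at heq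
      exact hd x (hx'.resolve_left hxA) y (hy'.resolve_left hyA) hxy (σ.injective heq)

end Coloring

section Cographs

variable {V : Type*} {G : SimpleGraph V}

lemma P4FreeOn.mono {S T : Set V} (h : P4FreeOn G T) (hST : S ⊆ T) : P4FreeOn G S :=
  fun a ha b hb c hc d hd => h a (hST ha) b (hST hb) c (hST hc) d (hST hd)

lemma P4FreeOn.compl {S : Set V} (h : P4FreeOn G S) : P4FreeOn Gᶜ S := by
  intro a ha b hb c hc d hd hab hbc hcd hac had hbd nac nad nbd
  simp only [compl_adj, not_and, not_not] at *
  exact h b hb d hd a ha c hc (nbd hbd) (nad had).symm (nac hac) hab.1.symm hbc.1 hcd.1.symm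
    (fun h => hab.2 h.symm) hbc.2 (fun h => hcd.2 h.symm)

lemma splitsComplete_compl {S : Set V} : SplitsComplete Gᶜ S ↔ SplitsAnticomplete G S := by
  constructor <;> rintro ⟨A, B, hA, hB, hdis, hAB, h⟩ <;> refine ⟨A, B, hA, hB, hdis, hAB, ?_⟩
  · exact fun a ha b hb => ((G.compl_adj a b).1 (h a ha b hb)).2
  · exact fun a ha b hb => (G.compl_adj a b).2
      ⟨fun hab => Set.disjoint_left.1 hdis ha (hab ▸ hb), h a ha b hb⟩

lemma splitsAnticomplete_insert_of_anticomplete {A B : Set V} {v : V} (hA : A.Nonempty)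
    (hdis : Disjoint A B) (hv : v ∉ A) (hvA : ∀ a ∈ A, ¬ G.Adj v a)
    (h : ∀ a ∈ A, ∀ b ∈ B, ¬ G.Adj a b) : SplitsAnticomplete G (insert v (A ∪ B)) := by
  refine ⟨A, insert v B, hA, ⟨v, Set.mem_insert v B⟩, ?_, ?_, ?_⟩
  · rw [Set.disjoint_insert_right]
    exact ⟨hv, hdis⟩
  · rw [Set.union_insert]
  · rintro a ha b (rfl | hb)
    · exact fun h => hvA a ha h.symm
    · exact h a ha b hb

/-- Adding a vertex to a disconnected set in a graph without induced `P₄`. -/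
lemma SplitsAnticomplete.insert_of_p4FreeOn {S : Set V} {v : V} (hv : v ∉ S)
    (hS : SplitsAnticomplete G S) (hfree : P4FreeOn G (insert v S)) :
    SplitsAnticomplete G (insert v S) ∨ SplitsComplete G (insert v S) := by
  obtain ⟨A, B, hA, hB, hdis, rfl, hanti⟩ := hS
  by_cases hall : ∀ x ∈ A ∪ B, G.Adj v x
  · refine Or.inr ⟨{v}, A ∪ B, ⟨v, rfl⟩, hA.inl, Set.disjoint_singleton_left.2 hv,
      Set.singleton_union, ?_⟩
    rintro _ rfl
    exact hall
  left
  push Not at hall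
  obtain ⟨x, hx, hvx⟩ := hall
  wlog hxA : x ∈ A generalizing A B
  · rw [Set.union_comm] at hv hx hfree ⊢
    exact this B A hB hA hdis.symm (fun b hb a ha h => hanti a ha b hb h.symm) hv hfree hx
      (hx.resolve_right hxA)
  rw [Set.mem_union, not_or] at hv
  by_cases hvB : ∀ b ∈ B, ¬ G.Adj v b
  · rw [Set.union_comm]
    exact splitsAnticomplete_insert_of_anticomplete hB hdis.symm hv.2 hvB
      fun b hb a ha h => hanti a ha b hb h.symm
  push Not at hvB
  obtain ⟨b, hb, hvb⟩ := hvB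
  have hsplit : A ∪ B = {a ∈ A | ¬ G.Adj v a} ∪ ({a ∈ A | G.Adj v a} ∪ B) := by
    ext z
    simp only [Set.mem_union, Set.mem_ofPred_eq]
    tauto
  have hne : ∀ a ∈ A, a ≠ b := fun a ha hab => Set.disjoint_left.1 hdis ha (hab ▸ hb)
  have hanti' : ∀ a ∈ {a ∈ A | ¬ G.Adj v a}, ∀ z ∈ {a ∈ A | G.Adj v a} ∪ B, ¬ G.Adj a z := by
    rintro a ⟨ha, hva⟩ z (⟨hz, hvz⟩ | hz)
    · intro haz
      exact hfree a (Or.inr (Or.inl ha)) z (Or.inr (Or.inl hz)) v (Or.inl rfl) b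
        (Or.inr (Or.inr hb)) haz hvz.symm hvb (fun h => hv.1 (h ▸ ha)) (hne a ha) (hne z hz)
        (fun h => hva h.symm) (hanti a ha b hb) (hanti z hz b hb)
    · exact hanti a ha z hz
  rw [hsplit]
  refine splitsAnticomplete_insert_of_anticomplete ⟨x, hxA, hvx⟩ ?_ (fun h => hv.1 h.1)
    (fun a ha => ha.2) hanti'
  rw [Set.disjoint_left]
  rintro z ⟨hz, hvz⟩ (h | h)
  · exact hvz h.2
  · exact Set.disjoint_left.1 hdis hz h

/-- Seinsche's theorem: a set of at least two vertices containing no induced `P₄` is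
disconnected in the graph or in its complement. -/
lemma P4FreeOn.splits {S : Set V} (hfin : S.Finite) (hS : S.Nontrivial) (hfree : P4FreeOn G S) :
    SplitsAnticomplete G S ∨ SplitsComplete G S := by
  induction S, hfin using Set.Finite.induction_on with
  | empty => exact absurd hS Set.not_nontrivial_empty
  | @insert v S hv hfin ih =>
    by_cases hnt : S.Nontrivial
    · rcases ih hnt (hfree.mono (Set.subset_insert v S)) with h | h
      · exact h.insert_of_p4FreeOn hv hfree
      · rw [← compl_compl G, splitsComplete_compl] at h
        rcases h.insert_of_p4FreeOn hv hfree.compl with h | h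
        · exact Or.inr (by rwa [← splitsComplete_compl, compl_compl] at h)
        · exact Or.inl (splitsComplete_compl.1 h)
    · rw [Set.not_nontrivial_iff] at hnt
      obtain ⟨w, hw⟩ : S.Nonempty := by
        by_contra hemp
        rw [Set.not_nonempty_iff_eq_empty] at hemp
        subst hemp
        simp at hS
      obtain rfl : S = {w} := hnt.eq_singleton_of_mem hw
      by_cases hvw : G.Adj v w
      · exact Or.inr ⟨{v}, {w}, ⟨v, rfl⟩, ⟨w, rfl⟩, by simpa using hv, rfl,
          by simpa using hvw⟩
      · exact Or.inl ⟨{v}, {w}, ⟨v, rfl⟩, ⟨w, rfl⟩, by simpa using hv, rfl,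
          by simpa using hvw⟩

/-- Every finite set is the disjoint union of pairwise complete sets that cannot be split
further into two complete parts. -/
lemma exists_coComponents {S : Set V} (hfin : S.Finite) :
    ∃ (k : ℕ) (X : Fin k → Set V), (∀ i, (X i).Nonempty) ∧
      (∀ i j, i ≠ j → Disjoint (X i) (X j)) ∧
      (∀ i j, i ≠ j → ∀ u ∈ X i, ∀ v ∈ X j, G.Adj u v) ∧ S = ⋃ i, X i ∧
      ∀ i, ¬ SplitsComplete G (X i) := by
  suffices h : ∃ (ι : Type) (_ : Finite ι) (X : ι → Set V), (∀ i, (X i).Nonempty) ∧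
      (∀ i j, i ≠ j → ∀ u ∈ X i, ∀ v ∈ X j, G.Adj u v) ∧ S = ⋃ i, X i ∧
      ∀ i, ¬ SplitsComplete G (X i) by
    obtain ⟨ι, _, X, hne, hadj, hS, hX⟩ := h
    let e := Finite.equivFin ι
    have hadj' : ∀ i j, i ≠ j → ∀ u ∈ X (e.symm i), ∀ v ∈ X (e.symm j), G.Adj u v :=
      fun i j hij => hadj _ _ (e.symm.injective.ne hij)
    refine ⟨Nat.card ι, fun i => X (e.symm i), fun i => hne _, fun i j hij => ?_, hadj', ?_,
      fun i => hX _⟩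
    · rw [Set.disjoint_left]
      exact fun x hx hx' => G.irrefl (hadj' i j hij x hx x hx')
    · rw [hS]
      exact (e.symm.surjective.iUnion_comp X).symm
  induction hn : S.ncard using Nat.strong_induction_on generalizing S with
  | _ n ih =>
    by_cases hs : SplitsComplete G S
    · obtain ⟨A, B, hA, hB, hdis, rfl, hadj⟩ := hs
      have hfA := hfin.subset (Set.subset_union_left : A ⊆ A ∪ B)
      have hfB := hfin.subset (Set.subset_union_right : B ⊆ A ∪ B)
      rw [Set.ncard_union_eq hdis hfA hfB] at hn
      have hA' := (Set.ncard_pos hfA).2 hA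
      have hB' := (Set.ncard_pos hfB).2 hB
      obtain ⟨ι, _, X, hXne, hXadj, rfl, hX⟩ := ih _ (by omega) hfA rfl
      obtain ⟨κ, _, Y, hYne, hYadj, rfl, hY⟩ := ih _ (by omega) hfB rfl
      refine ⟨ι ⊕ κ, inferInstance, Sum.elim X Y, ?_, ?_, ?_, ?_⟩
      · rintro (i | i)
        exacts [hXne i, hYne i]
      · have hcross : ∀ i j, ∀ u ∈ X i, ∀ v ∈ Y j, G.Adj u v := fun i j u hu v hv =>
          hadj u (Set.mem_iUnion_of_mem i hu) v (Set.mem_iUnion_of_mem j hv)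
        rintro (i | i) (j | j) hij u hu v hv
        · exact hXadj i j (fun h => hij (h ▸ rfl)) u hu v hv
        · exact hcross i j u hu v hv
        · exact (hcross j i v hv u hu).symm
        · exact hYadj i j (fun h => hij (h ▸ rfl)) u hu v hv
      · rw [Set.iUnion_sum]
        rfl
      · rintro (i | i)
        exacts [hX i, hY i]
    · rcases S.eq_empty_or_nonempty with rfl | hne
      · exact ⟨Empty, inferInstance, Empty.elim, nofun, nofun, by simp, nofun⟩
      · exact ⟨Unit, inferInstance, fun _ => S, fun _ => hne, fun i j h => absurd rfl h,
          (Set.iUnion_const S).symm, fun _ => hs⟩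

end Cographs

section Modules

variable {V : Type*} {G : SimpleGraph V}

lemma IndFree.false_of_embedding {α β : Type*} {H : SimpleGraph α} {G : SimpleGraph β}
    (h : IndFree H G) (φ : H ↪g G) : False :=
  h (Set.range φ) ⟨⟨Equiv.ofInjective φ φ.injective, φ.map_rel_iff⟩⟩

lemma IndFree.induce {α β : Type*} {H : SimpleGraph α} {G : SimpleGraph β}
    (h : IndFree H G) (C : Set β) : IndFree H (G.induce C) := by
  rintro s ⟨φ⟩
  exact h.false_of_embedding
    ((Embedding.induce C).comp ((Embedding.induce s).comp φ.toEmbedding))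

/-- The vertices of an induced `Q(P₄)`. -/
lemma IndFree.false_of_config (h : IndFree (QGraph (pathGraph 4)) G) {a b c d x y z : V}
    (hab : G.Adj a b) (hbc : G.Adj b c) (hcd : G.Adj c d) (hac : a ≠ c) (had : a ≠ d)
    (hbd : b ≠ d) (nac : ¬ G.Adj a c) (nad : ¬ G.Adj a d) (nbd : ¬ G.Adj b d)
    (hx : ∀ v, v = a ∨ v = b ∨ v = c ∨ v = d → x ≠ v ∧ ¬ G.Adj x v)
    (hy : ∀ v, v = a ∨ v = b ∨ v = c ∨ v = d → G.Adj y v)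
    (hz : ∀ v, v = a ∨ v = b ∨ v = c ∨ v = d → G.Adj z v)
    (hxy : G.Adj x y) (hxz : x ≠ z) (nxz : ¬ G.Adj x z) (hyz : y ≠ z) (nyz : ¬ G.Adj y z) :
    False := by
  simp only [forall_eq_or_imp, forall_eq] at hx hy hz
  obtain ⟨⟨xa, xa'⟩, ⟨xb, xb'⟩, ⟨xc, xc'⟩, xd, xd'⟩ := hx
  obtain ⟨ya, yb, yc, yd⟩ := hy
  obtain ⟨za, zb, zc, zd⟩ := hz
  let φ : Fin 4 ⊕ Fin 3 → V := Sum.elim ![a, b, c, d] ![x, y, z]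
  have hφ : Function.Injective φ := by
    rintro (i | i) (j | j) hij <;> fin_cases i <;> fin_cases j <;>
      simp [φ] at hij ⊢ <;> grind [SimpleGraph.irrefl, SimpleGraph.symm]
  have hrel : ∀ i j, G.Adj (φ i) (φ j) ↔ (QGraph (pathGraph 4)).Adj i j := by
    rintro (i | i) (j | j) <;> fin_cases i <;> fin_cases j <;>
      simp [φ, QGraph, pathGraph_adj, *, G.adj_comm] <;> grind [SimpleGraph.adj_comm]
  exact h.false_of_embedding ⟨⟨φ, hφ⟩, hrel _ _⟩

/-- In a critical `Q(P₄)`-free graph with connected complement, no proper module contains an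
induced `P₄`: otherwise its neighbourhood is a clique-separator of modules. -/
lemma IsCriticalAt.p4FreeOn_module [Finite V] {n : ℕ} (hG : IsCriticalAt G n)
    (hfree : IndFree (QGraph (pathGraph 4)) G) (hco : ¬ SplitsComplete G Set.univ) {M : Set V}
    (hM : IsModule G M) (hne : M ≠ Set.univ) : P4FreeOn G M := by
  intro a ha b hb c hc d hd hab hbc hcd hac had hbd nac nad nbd
  let N : Set V := {v | v ∉ M ∧ ∀ u ∈ M, G.Adj v u}
  let R : Set V := {v | v ∉ M ∧ ∀ u ∈ M, ¬ G.Adj v u}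
  have hcases : ∀ v, v ∈ M ∨ v ∈ N ∨ v ∈ R := by
    intro v
    by_cases hv : v ∈ M
    · exact Or.inl hv
    · exact Or.inr ((hM.2 v hv).imp (fun h => ⟨hv, h⟩) (fun h => ⟨hv, h⟩))
  have hNR : Disjoint N R := Set.disjoint_left.2 fun v hv hv' => hv'.2 a ha (hv.2 a ha)
  have hR : R.Nonempty := by
    by_contra hR
    rw [Set.not_nonempty_iff_eq_empty] at hR
    refine hco ⟨M, Mᶜ, hM.1, Set.nonempty_compl.2 hne, disjoint_compl_right,
      Set.union_compl_self M, fun u hu v hv => ?_⟩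
    rcases hcases v with h | h | h
    · exact absurd h hv
    · exact (h.2 u hu).symm
    · exact absurd h (hR ▸ Set.notMem_empty v)
  obtain ⟨k, X, hXne, hXdis, hXadj, hNX, hXco⟩ := exists_coComponents (G := G) (Set.toFinite N)
  have hXN : ∀ i, X i ⊆ N := fun i => hNX ▸ Set.subset_iUnion X i
  refine hG.not_isCliqueSeparatorOfModules N ⟨⟨k, X, fun i => ⟨hXne i, fun v hv => ?_⟩, hXdis,
    hXadj, hNX⟩, M ∪ N, N ∪ R, ?_, ?_, ?_, ?_, ?_⟩
  · rcases hcases v with h | h | h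
    · exact Or.inl fun u hu => ((hXN i hu).2 v h).symm
    · rw [hNX] at h
      obtain ⟨j, hj⟩ := Set.mem_iUnion.1 h
      exact Or.inl fun u hu => hXadj j i (fun hji => hv (hji ▸ hj)) v hj u hu
    · by_contra! hmix
      obtain ⟨⟨z, hz, hvz⟩, y, hy, hvy⟩ := hmix
      refine hXco i ⟨{u ∈ X i | G.Adj v u}, {u ∈ X i | ¬ G.Adj v u}, ⟨y, hy, hvy⟩,
        ⟨z, hz, hvz⟩, Set.disjoint_left.2 fun u hu hu' => hu'.2 hu.2, ?_, ?_⟩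
      · ext u
        simp only [Set.mem_union, Set.mem_ofPred_eq]
        tauto
      · rintro y ⟨hy, hvy⟩ z ⟨hz, hvz⟩
        by_contra hyz
        have hmem : ∀ w, w = a ∨ w = b ∨ w = c ∨ w = d → w ∈ M := by
          rintro w (rfl | rfl | rfl | rfl) <;> assumption
        exact hfree.false_of_config hab hbc hcd hac had hbd nac nad nbd
          (x := v) (y := y) (z := z)
          (fun w hw => ⟨fun hvw => h.1 (hvw ▸ hmem w hw), h.2 w (hmem w hw)⟩)
          (fun w hw => (hXN i hy).2 w (hmem w hw)) (fun w hw => (hXN i hz).2 w (hmem w hw))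
          hvy (fun hvz' => hv (hvz' ▸ hz)) hvz (fun hyz' => hvz (hyz' ▸ hvy)) hyz
  · ext v
    have := hcases v
    simp only [Set.mem_union, Set.mem_univ, iff_true]
    tauto
  · exact ⟨a, Or.inl ha, fun h => h.elim (fun h => h.1 ha) (fun h => h.1 ha)⟩
  · obtain ⟨r, hr⟩ := hR
    exact ⟨r, Or.inr hr, fun h => h.elim hr.1 fun h => Set.disjoint_left.1 hNR h hr⟩
  · rintro u ⟨hu, hu'⟩ v ⟨hv, hv'⟩ huv
    have hu : u ∈ M := hu.resolve_right fun h => hu' (Or.inl h)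
    have hv : v ∈ R := hv.resolve_left fun h => hv' (Or.inr h)
    exact hv.2 u hu huv.symm
  · ext v
    have h1 : v ∈ N → v ∉ R := fun h => Set.disjoint_left.1 hNR h
    have h2 : v ∈ R → v ∉ M := fun h => h.1
    simp only [Set.mem_union, Set.mem_inter_iff]
    tauto

lemma IsModule.of_union_complete {A B : Set V} (hA : A.Nonempty) (hM : IsModule G (A ∪ B))
    (h : ∀ a ∈ A, ∀ b ∈ B, G.Adj a b) : IsModule G A := by
  refine ⟨hA, fun v hv => ?_⟩
  by_cases hvB : v ∈ B
  · exact Or.inl fun a ha => (h a ha v hvB).symm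
  · exact (hM.2 v fun h => h.elim hv hvB).imp (fun h a ha => h a (Or.inl ha))
      (fun h a ha => h a (Or.inl ha))

/-- In a critical `Q(P₄)`-free graph with connected complement, every proper module is a
clique. -/
lemma IsCriticalAt.isClique_module [Finite V] {n : ℕ} (hG : IsCriticalAt G n)
    (hfree : IndFree (QGraph (pathGraph 4)) G) (hco : ¬ SplitsComplete G Set.univ) {M : Set V}
    (hM : IsModule G M) (hne : M ≠ Set.univ) : G.IsClique M := by
  induction hk : M.ncard using Nat.strong_induction_on generalizing M with
  | _ k ih =>
    by_cases hnt : M.Nontrivial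
    · rcases (hG.p4FreeOn_module hfree hco hM hne).splits (Set.toFinite M) hnt with h | h
      · exact absurd h (hG.not_splitsAnticomplete hM)
      · obtain ⟨A, B, hA, hB, hdis, rfl, hadj⟩ := h
        rw [Set.ncard_union_eq hdis] at hk
        have hA' := (Set.ncard_pos).2 hA
        have hB' := (Set.ncard_pos).2 hB
        have hAne : A ≠ Set.univ := fun h => hne (by rw [h, Set.univ_union])
        have hBne : B ≠ Set.univ := fun h => hne (by rw [h, Set.union_univ])
        have hAc := ih _ (by omega) (hM.of_union_complete hA hadj) hAne rfl
        have hBc := ih _ (by omega) (IsModule.of_union_complete hB (Set.union_comm A B ▸ hM)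
          fun b hb a ha => (hadj a ha b hb).symm) hBne rfl
        rintro u (hu | hu) v (hv | hv) huv
        · exact hAc hu hv huv
        · exact hadj u hu v hv
        · exact (hadj v hv u hu).symm
        · exact hBc hu hv huv
    · exact (Set.not_nontrivial_iff.1 hnt).pairwise _

end Modules

section TrueTwins

variable {V W : Type*} {G : SimpleGraph V} {H : SimpleGraph W} {f : V → W}

lemma IsModule.preimage (hf : Function.Surjective f)
    (hadj : ∀ u v, f u ≠ f v → (G.Adj u v ↔ H.Adj (f u) (f v))) {M : Set W}
    (hM : IsModule H M) : IsModule G (f ⁻¹' M) := by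
  refine ⟨hM.1.preimage hf, fun v hv => ?_⟩
  have hne : ∀ u ∈ f ⁻¹' M, f v ≠ f u := fun u hu h => hv (by rwa [Set.mem_preimage, h])
  exact (hM.2 (f v) hv).imp (fun h u hu => (hadj v u (hne u hu)).2 (h _ hu))
    (fun h u hu huv => h _ hu ((hadj v u (hne u hu)).1 huv))

lemma IsCliqueSeparatorOfModules.preimage (hf : Function.Surjective f)
    (hadj : ∀ u v, f u ≠ f v → (G.Adj u v ↔ H.Adj (f u) (f v))) {X : Set W}
    (hX : IsCliqueSeparatorOfModules H X) : IsCliqueSeparatorOfModules G (f ⁻¹' X) := by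
  obtain ⟨⟨k, Xs, hmod, hdis, hXadj, rfl⟩, A, B, hAB, ⟨a, ha⟩, ⟨b, hb⟩, hanti, hABX⟩ := hX
  refine ⟨⟨k, fun i => f ⁻¹' Xs i, fun i => (hmod i).preimage hf hadj,
    fun i j hij => (hdis i j hij).preimage f, fun i j hij u hu v hv => ?_, Set.preimage_iUnion⟩,
    f ⁻¹' A, f ⁻¹' B, ?_, ?_, ?_, ?_, ?_⟩
  · refine (hadj u v fun h => ?_).2 (hXadj i j hij _ hu _ hv)
    exact Set.disjoint_left.1 (hdis i j hij) hu (by rwa [h])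
  · rw [← Set.preimage_union, hAB, Set.preimage_univ]
  · obtain ⟨u, rfl⟩ := hf a
    exact ⟨u, ha⟩
  · obtain ⟨u, rfl⟩ := hf b
    exact ⟨u, hb⟩
  · intro u hu v hv huv
    refine hanti _ hu _ hv ((hadj u v fun h => ?_).1 huv)
    exact hu.2 (Set.mem_preimage.2 (h ▸ hv.1))
  · rw [← Set.preimage_inter, hABX]

/-- Contracting the classes of true twins. -/
lemma exists_trueTwin_quotient [Finite V] (G : SimpleGraph V) :
    ∃ (m : ℕ) (H : SimpleGraph (Fin m)) (f : V → Fin m), Function.Surjective f ∧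
      (∀ u v, f u ≠ f v → (G.Adj u v ↔ H.Adj (f u) (f v))) ∧
      ∀ u v, f u = f v ↔ insert u (G.neighborSet u) = insert v (G.neighborSet v) := by
  let N : V → Set V := fun u => insert u (G.neighborSet u)
  have hN : ∀ u v, v ∈ N u ↔ v = u ∨ G.Adj u v := fun u v => Iff.rfl
  let e := Finite.equivFin (Set.range N)
  let f : V → Fin (Nat.card (Set.range N)) := fun u => e ⟨N u, u, rfl⟩
  have hf : ∀ u v, f u = f v ↔ N u = N v := fun u v =>
    e.injective.eq_iff.trans Subtype.mk_eq_mk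
  have htwin : ∀ u u' v, N u = N u' → N u ≠ N v → G.Adj u' v → G.Adj u v := by
    intro u u' v h hne huv
    have hv : v ∈ N u := h ▸ Or.inr huv
    exact ((hN u v).1 hv).resolve_left fun h => hne (h ▸ rfl)
  refine ⟨_, SimpleGraph.mk (fun p q => p ≠ q ∧ ∃ u v, f u = p ∧ f v = q ∧ G.Adj u v)
    ?_ ?_, f, ?_, ?_, hf⟩
  · exact ⟨fun p q ⟨hpq, u, v, hu, hv, huv⟩ => ⟨hpq.symm, v, u, hv, hu, huv.symm⟩⟩
  · exact ⟨fun p hp => hp.1 rfl⟩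
  · intro p
    obtain ⟨⟨_, u, rfl⟩, rfl⟩ := e.surjective p
    exact ⟨u, rfl⟩
  · intro u v huv
    refine ⟨fun h => ⟨huv, u, v, rfl, rfl, h⟩, ?_⟩
    rintro ⟨-, u', v', hu, hv, h⟩
    rw [hf] at hu hv
    rw [Ne, hf] at huv
    refine htwin u u' v hu.symm huv (htwin v v' u' hv.symm ?_ h.symm).symm
    rw [hu]
    exact Ne.symm huv

/-- A critical `Q(P₄)`-free graph with connected complement is an expansion, by nonempty
cliques, of a prime graph without clique-separators of modules. -/
lemma IsCriticalAt.exists_expansion [Finite V] {n : ℕ} (hG : IsCriticalAt G n)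
    (hfree : IndFree (QGraph (pathGraph 4)) G) (hco : ¬ SplitsComplete G Set.univ) :
    ∃ (m : ℕ) (H : SimpleGraph (Fin m)), IsPrime H ∧
      (∀ X : Set (Fin m), ¬ IsCliqueSeparatorOfModules H X) ∧ IsExpansionOf G H := by
  obtain ⟨m, H, f, hf, hadj, htwin⟩ := exists_trueTwin_quotient G
  refine ⟨m, H, ?_, fun X hX => hG.not_isCliqueSeparatorOfModules _ (hX.preimage hf hadj),
    f, hf, fun u v huv h => ?_, hadj⟩
  · rintro ⟨M, hM, hlt, hcard⟩
    have hMne : M ≠ Set.univ := by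
      rintro rfl
      rw [Set.ncard_univ] at hcard
      exact hcard.false
    have hpre := hM.preimage hf hadj
    have hclique := hG.isClique_module hfree hco hpre fun h =>
      hMne (Set.preimage_injective.2 hf (h.trans Set.preimage_univ.symm))
    obtain ⟨p, hp, q, hq, hpq⟩ := Set.one_lt_ncard_iff_nontrivial.1 hlt
    obtain ⟨u, rfl⟩ := hf p
    obtain ⟨v, rfl⟩ := hf q
    refine hpq ((htwin u v).2 ?_)
    ext w
    simp only [Set.mem_insert_iff, mem_neighborSet]
    by_cases hw : w ∈ f ⁻¹' M
    · have h1 : w ≠ u → G.Adj u w := fun h => hclique hp hw h.symm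
      have h2 : w ≠ v → G.Adj v w := fun h => hclique hq hw h.symm
      tauto
    · have h1 : w ≠ u := fun h => hw (h ▸ hp)
      have h2 : w ≠ v := fun h => hw (h ▸ hq)
      rw [G.adj_comm u, G.adj_comm v]
      rcases hpre.2 w hw with h | h
      · simp [h u hp, h v hq]
      · simp [h u hp, h v hq, h1, h2]
  · have hv : v ∈ insert u (G.neighborSet u) := (htwin u v).1 h ▸ Set.mem_insert v _
    exact hv.resolve_left huv.symm

end TrueTwins

/-- If `G` is a finite critical `Q(P₄)`-free graph, then `V(G)` can be partitioned
into nonempty sets `M₁, …, M_k`, pairwise completely joined, such that each `G[Mᵢ]`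
is a `non-empty, 2K₁-free'-expansion of a prime graph without clique-separators of
modules. -/
theorem stmt13 {V : Type} [Fintype V] (G : SimpleGraph V) (hcrit : IsCritical G)
    (hfree : IndFree (QGraph (pathGraph 4)) G) :
    ∃ (k : ℕ) (M : Fin k → Set V), 0 < k ∧
      (∀ i, (M i).Nonempty) ∧
      (∀ i j, i ≠ j → Disjoint (M i) (M j)) ∧
      (⋃ i, M i) = Set.univ ∧
      (∀ i j, i ≠ j → ∀ u ∈ M i, ∀ v ∈ M j, G.Adj u v) ∧
      (∀ i, ∃ (m : ℕ) (Gp : SimpleGraph (Fin m)), IsPrime Gp ∧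
        (∀ X : Set (Fin m), ¬ IsCliqueSeparatorOfModules Gp X) ∧
        IsExpansionOf (G.induce (M i)) Gp) := by
  obtain ⟨n, hn⟩ := hcrit.exists_isCriticalAt
  obtain ⟨k, M, hne, hdis, hadj, huniv, hco⟩ := exists_coComponents (G := G) (Set.toFinite Set.univ)
  have hcover : ∀ v, ∃ i, v ∈ M i := fun v => Set.mem_iUnion.1 (huniv ▸ Set.mem_univ v)
  obtain ⟨v⟩ := hcrit.1
  obtain ⟨i₀, -⟩ := hcover v
  refine ⟨k, M, i₀.pos, hne, hdis, huniv.symm, hadj, fun i => ?_⟩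
  have hjoin : ∀ x ∈ M i, ∀ y ∉ M i, G.Adj x y := by
    intro x hx y hy
    obtain ⟨j, hj⟩ := hcover y
    exact hadj i j (fun hij => hy (hij ▸ hj)) x hx y hj
  obtain ⟨m, hm⟩ := hn.induce_of_join (hne i) hjoin
  refine hm.exists_expansion (hfree.induce (M i)) ?_
  rintro ⟨A, B, hA, hB, hdisAB, hAB, hcomp⟩
  refine hco i ⟨Subtype.val '' A, Subtype.val '' B, hA.image _, hB.image _,
    Set.disjoint_image_of_injective Subtype.val_injective hdisAB, ?_, ?_⟩
  · rw [← Set.image_union, hAB, Subtype.coe_image_univ]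
  · rintro _ ⟨a, ha, rfl⟩ _ ⟨b, hb, rfl⟩
    exact hcomp a ha b hb
end
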